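/- For every τ in the upper half-plane, G̃_{2,2,2,2}(τ) = G₈(τ) + (4π²/(3τ²)) G₆(τ) + (14π⁴/(15τ⁴)) G₄(τ) + (16π⁶/(35τ⁶)) G₂(τ) − 86π⁸/(525τ⁸). -/

import Mathlib

open Real

/-- The Eisenstein series `G_k(τ)` (iterated summation, inner over `n`). -/
noncomputable def G (k : ℕ) (τ : ℂ) : ℂ :=
  ∑' m : ℤ, ∑' n : ℤ, if m = 0 ∧ n = 0 then 0 else 1 / ((m : ℂ) + n * τ) ^ k

/-- The quadruple Eisenstein-type series `G̃_{2,2,2,2}(τ)` (iterated order). -/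
noncomputable def tildeG4 (τ : ℂ) : ℂ :=
  ∑' m : ℤ, ∑' n₁ : ℤ, ∑' n₂ : ℤ, ∑' n₃ : ℤ, ∑' n₄ : ℤ,
    if (m = 0 ∧ n₁ = 0) ∨ (m = 0 ∧ n₂ = 0) ∨ (m = 0 ∧ n₃ = 0) ∨ (m = 0 ∧ n₄ = 0) then 0
    else 1 / (((m : ℂ) + n₁ * τ) ^ 2 * ((m : ℂ) + n₂ * τ) ^ 2 *
              ((m : ℂ) + n₃ * τ) ^ 2 * ((m : ℂ) + n₄ * τ) ^ 2)

noncomputable def auxA (p : ℕ) (q : ℂ) : ℂ := ∑' n : ℕ, (n : ℂ) ^ p * q ^ n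

lemma auxA_rec (p : ℕ) (hp : p ≠ 0) (q : ℂ) (hq : ‖q‖ < 1) :
    auxA p q = q * ∑ j ∈ Finset.range (p + 1), (p.choose j : ℂ) * auxA j q := by
  have hs : ∀ j : ℕ, Summable fun n : ℕ => (n : ℂ) ^ j * q ^ n := fun j =>
    summable_pow_mul_geometric_of_norm_lt_one j hq
  unfold auxA
  rw [(hs p).tsum_eq_zero_add]
  simp_rw [← tsum_mul_left]
  rw [← Summable.tsum_finsetSum (fun j _ => (hs j).mul_left _), ← tsum_mul_left]
  simp only [Nat.cast_zero, zero_pow hp, zero_mul, zero_add]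
  refine tsum_congr fun n => ?_
  push_cast
  rw [add_pow, pow_succ, Finset.sum_mul, Finset.mul_sum]
  refine Finset.sum_congr rfl fun j _ => ?_
  simp
  ring

lemma auxA_zero (q : ℂ) (hq : ‖q‖ < 1) : auxA 0 q = 1 / (1 - q) := by
  simp [auxA, tsum_geometric_of_norm_lt_one hq]

noncomputable def auxY (q : ℂ) : ℂ := -4 * (π : ℂ) ^ 2 * q / (1 - q) ^ 2

lemma auxA_vals (q : ℂ) (hq : ‖q‖ < 1) :
    auxA 1 q = q / (1 - q) ^ 2 ∧
    auxA 3 q = q / (1 - q) ^ 2 + 6 * (q / (1 - q) ^ 2) ^ 2 ∧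
    auxA 5 q = q / (1 - q) ^ 2 + 30 * (q / (1 - q) ^ 2) ^ 2 + 120 * (q / (1 - q) ^ 2) ^ 3 ∧
    auxA 7 q = q / (1 - q) ^ 2 + 126 * (q / (1 - q) ^ 2) ^ 2 + 1680 * (q / (1 - q) ^ 2) ^ 3 +
      5040 * (q / (1 - q) ^ 2) ^ 4 := by
  have hne : 1 - q ≠ 0 := by
    intro h
    have : q = 1 := by linear_combination -h
    simp [this] at hq
  have key : ∀ a b : ℂ, a = q * (b + a) → a = q * b / (1 - q) := by
    intro a b h
    field_simp
    linear_combination h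
  have h0 := auxA_zero q hq
  have h1 := key _ _ ((auxA_rec 1 (by norm_num) q hq).trans (by rw [Finset.sum_range_succ, Nat.choose_self, Nat.cast_one, one_mul]))
  have h2 := key _ _ ((auxA_rec 2 (by norm_num) q hq).trans (by rw [Finset.sum_range_succ, Nat.choose_self, Nat.cast_one, one_mul]))
  have h3 := key _ _ ((auxA_rec 3 (by norm_num) q hq).trans (by rw [Finset.sum_range_succ, Nat.choose_self, Nat.cast_one, one_mul]))
  have h4 := key _ _ ((auxA_rec 4 (by norm_num) q hq).trans (by rw [Finset.sum_range_succ, Nat.choose_self, Nat.cast_one, one_mul]))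
  have h5 := key _ _ ((auxA_rec 5 (by norm_num) q hq).trans (by rw [Finset.sum_range_succ, Nat.choose_self, Nat.cast_one, one_mul]))
  have h6 := key _ _ ((auxA_rec 6 (by norm_num) q hq).trans (by rw [Finset.sum_range_succ, Nat.choose_self, Nat.cast_one, one_mul]))
  have h7 := key _ _ ((auxA_rec 7 (by norm_num) q hq).trans (by rw [Finset.sum_range_succ, Nat.choose_self, Nat.cast_one, one_mul]))
  simp [Finset.sum_range_succ, Nat.choose] at h1 h2 h3 h4 h5 h6 h7
  have e1 : auxA 1 q = q / (1 - q) ^ 2 := by rw [h1, h0]; field_simp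
  have e2 : auxA 2 q = (q + q ^ 2) / (1 - q) ^ 3 := by
    rw [h2, h0, e1]; field_simp; ring
  have e3 : auxA 3 q = (q + 4 * q ^ 2 + q ^ 3) / (1 - q) ^ 4 := by
    rw [h3, h0, e1, e2]; field_simp; ring
  have e4 : auxA 4 q = (q + 11 * q ^ 2 + 11 * q ^ 3 + q ^ 4) / (1 - q) ^ 5 := by
    rw [h4, h0, e1, e2, e3]; field_simp; ring
  have e5 : auxA 5 q = (q + 26 * q ^ 2 + 66 * q ^ 3 + 26 * q ^ 4 + q ^ 5) / (1 - q) ^ 6 := by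
    rw [h5, h0, e1, e2, e3, e4]; field_simp; ring
  have e6 : auxA 6 q = (q + 57 * q ^ 2 + 302 * q ^ 3 + 302 * q ^ 4 + 57 * q ^ 5 + q ^ 6)
      / (1 - q) ^ 7 := by
    rw [h6, h0, e1, e2, e3, e4, e5]; field_simp; ring
  have e7 : auxA 7 q = (q + 120 * q ^ 2 + 1191 * q ^ 3 + 2416 * q ^ 4 + 1191 * q ^ 5
      + 120 * q ^ 6 + q ^ 7) / (1 - q) ^ 8 := by
    rw [h7, h0, e1, e2, e3, e4, e5, e6]; field_simp; ring
  refine ⟨e1, ?_, ?_, ?_⟩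
  · rw [e3]; field_simp; ring
  · rw [e5]; field_simp; ring
  · rw [e7]; field_simp; ring

noncomputable def auxT (τ : ℂ) (k : ℕ) (m : ℤ) : ℂ := ∑' n : ℤ, 1 / ((m : ℂ) + n * τ) ^ k

lemma auxT_neg (τ : ℂ) (k : ℕ) (hk : Even k) (m : ℤ) : auxT τ k (-m) = auxT τ k m := by
  unfold auxT
  rw [← (Equiv.neg ℤ).tsum_eq]
  refine tsum_congr fun n => ?_
  simp only [Equiv.neg_apply, Int.cast_neg]
  rw [← hk.neg_pow]
  congr 2
  ring

lemma G_eq (k : ℕ) (hk : k ≠ 0) (τ : ℂ) : G k τ = ∑' m : ℤ, auxT τ k m := by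
  unfold G auxT
  refine tsum_congr fun m => tsum_congr fun n => ?_
  split_ifs with h
  · simp [h.1, h.2, hk]
  · rfl

lemma tildeG4_eq (τ : ℂ) : tildeG4 τ = ∑' m : ℤ, auxT τ 2 m ^ 4 := by
  unfold tildeG4
  refine tsum_congr fun m => ?_
  have : ∀ n₁ n₂ n₃ n₄ : ℤ, (if (m = 0 ∧ n₁ = 0) ∨ (m = 0 ∧ n₂ = 0) ∨ (m = 0 ∧ n₃ = 0) ∨
      (m = 0 ∧ n₄ = 0) then 0
    else 1 / (((m : ℂ) + n₁ * τ) ^ 2 * ((m : ℂ) + n₂ * τ) ^ 2 *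
              ((m : ℂ) + n₃ * τ) ^ 2 * ((m : ℂ) + n₄ * τ) ^ 2)) =
      1 / ((m : ℂ) + n₁ * τ) ^ 2 * (1 / ((m : ℂ) + n₂ * τ) ^ 2 *
        (1 / ((m : ℂ) + n₃ * τ) ^ 2 * (1 / ((m : ℂ) + n₄ * τ) ^ 2))) := by
    intro n₁ n₂ n₃ n₄
    split_ifs with h
    · rcases h with h | h | h | h <;> simp [h.1, h.2]
    · simp only [one_div, mul_inv]; ring
  simp_rw [this, tsum_mul_left, tsum_mul_right]
  unfold auxT
  ring

lemma auxT_neg_eq (τ : ℂ) (hτ : 0 < τ.im) (k N : ℕ) (hk : 1 ≤ k) :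
    auxT τ (k + 1) (-((N : ℤ) + 1)) = 1 / τ ^ (k + 1) *
      (((-2 * π * Complex.I) ^ (k + 1) / k.factorial) *
        auxA k (Complex.exp (-2 * π * Complex.I / τ) ^ (N + 1))) := by
  have h0 : τ ≠ 0 := by rintro rfl; simp at hτ
  have him : 0 < (-((N : ℂ) + 1) / τ).im := by
    have : (-((N : ℂ) + 1) / τ) = ((-((N : ℝ) + 1) : ℝ) : ℂ) * τ⁻¹ := by push_cast; ring
    rw [this, Complex.im_ofReal_mul, Complex.inv_im]
    have := Complex.normSq_pos.2 h0
    rw [neg_div, neg_mul_neg]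
    positivity
  have := EisensteinSeries.qExpansion_identity hk ⟨_, him⟩
  simp only [UpperHalfPlane.coe_mk] at this
  unfold auxA
  rw [← Complex.exp_nat_mul]
  have e : ((N + 1 : ℕ) : ℂ) * (-2 * π * Complex.I / τ) =
    2 * π * Complex.I * (-((N : ℂ) + 1) / τ) := by push_cast; ring
  rw [e, ← this, auxT, ← tsum_mul_left]
  refine tsum_congr fun n => ?_
  rw [one_div_mul_one_div, ← mul_pow]
  congr 2
  push_cast
  field_simp

lemma norm_auxQ (τ : ℂ) (hτ : 0 < τ.im) : ‖Complex.exp (-2 * π * Complex.I / τ)‖ < 1 := by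
  have h0 : τ ≠ 0 := by rintro rfl; simp at hτ
  have : (-2 * π * Complex.I / τ) = ((-2 * π : ℝ) : ℂ) * (Complex.I * τ⁻¹) := by push_cast; ring
  rw [Complex.norm_exp, Real.exp_lt_one_iff, this, Complex.re_ofReal_mul, Complex.I_mul_re,
    Complex.inv_im]
  have := Complex.normSq_pos.2 h0
  have := Real.pi_pos
  have : 0 < τ.im / Complex.normSq τ := by positivity
  rw [neg_div]
  nlinarith

lemma auxT_vals (τ : ℂ) (hτ : 0 < τ.im) (N : ℕ) (y : ℂ)
    (hy : y = auxY (Complex.exp (-2 * π * Complex.I / τ) ^ (N + 1))) :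
    auxT τ 2 (-((N : ℤ) + 1)) = 1 / τ ^ 2 * y ∧
    auxT τ 4 (-((N : ℤ) + 1)) = 1 / τ ^ 4 * (y ^ 2 - 2 / 3 * π ^ 2 * y) ∧
    auxT τ 6 (-((N : ℤ) + 1)) = 1 / τ ^ 6 * (y ^ 3 - π ^ 2 * y ^ 2 + 2 / 15 * π ^ 4 * y) ∧
    auxT τ 8 (-((N : ℤ) + 1)) = 1 / τ ^ 8 * (y ^ 4 - 4 / 3 * π ^ 2 * y ^ 3
      + 2 / 5 * π ^ 4 * y ^ 2 - 4 / 315 * π ^ 6 * y) := by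
  have hq : ‖Complex.exp (-2 * π * Complex.I / τ) ^ (N + 1)‖ < 1 := by
    rw [norm_pow]
    exact pow_lt_one₀ (norm_nonneg _) (norm_auxQ τ hτ) (by omega)
  obtain ⟨h1, h3, h5, h7⟩ := auxA_vals _ hq
  have hy' : y = -4 * (π : ℂ) ^ 2 * (Complex.exp (-2 * π * Complex.I / τ) ^ (N + 1) /
    (1 - Complex.exp (-2 * π * Complex.I / τ) ^ (N + 1)) ^ 2) := by
    rw [hy, auxY]; ring
  have I2 : (-2 * π * Complex.I) ^ 2 = -4 * (π : ℂ) ^ 2 := by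
    rw [mul_pow, Complex.I_sq]; ring
  have I4 : (-2 * π * Complex.I) ^ 4 = (-4 * (π : ℂ) ^ 2) ^ 2 := by rw [← I2]; ring
  have I6 : (-2 * π * Complex.I) ^ 6 = (-4 * (π : ℂ) ^ 2) ^ 3 := by rw [← I2]; ring
  have I8 : (-2 * π * Complex.I) ^ 8 = (-4 * (π : ℂ) ^ 2) ^ 4 := by rw [← I2]; ring
  refine ⟨?_, ?_, ?_, ?_⟩
  · rw [auxT_neg_eq τ hτ 1 N (by norm_num), h1, hy']
    norm_num only [Nat.factorial, I2]; push_cast; ring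
  · rw [auxT_neg_eq τ hτ 3 N (by norm_num), h3, hy']
    norm_num only [Nat.factorial, I4]; push_cast; ring
  · rw [auxT_neg_eq τ hτ 5 N (by norm_num), h5, hy']
    norm_num only [Nat.factorial, I6]; push_cast; ring
  · rw [auxT_neg_eq τ hτ 7 N (by norm_num), h7, hy']
    norm_num only [Nat.factorial, I8]; push_cast; ring

lemma summable_auxY (τ : ℂ) (hτ : 0 < τ.im) (j : ℕ) (hj : j ≠ 0) :
    Summable fun N : ℕ => auxY (Complex.exp (-2 * π * Complex.I / τ) ^ (N + 1)) ^ j := by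
  have hQ := norm_auxQ τ hτ
  set Q := Complex.exp (-2 * π * Complex.I / τ)
  have hs : Summable fun N : ℕ => (4 * π ^ 2 / (1 - ‖Q‖) ^ 2) ^ j * (‖Q‖ ^ j) ^ (N + 1) :=
    (((summable_nat_add_iff 1).2 (summable_geometric_of_lt_one (by positivity)
      (pow_lt_one₀ (norm_nonneg _) hQ hj)))).mul_left _
  refine Summable.of_norm_bounded hs fun N => ?_
  rw [← pow_mul, mul_comm j, pow_mul, ← mul_pow, norm_pow]
  gcongr
  unfold auxY
  rw [norm_div, norm_mul, norm_mul, norm_pow, norm_pow, norm_pow]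
  have h1 : 1 - ‖Q‖ ≤ ‖1 - Q ^ (N + 1)‖ := by
    have a := norm_sub_norm_le 1 (Q ^ (N + 1))
    rw [norm_one, norm_pow] at a
    have b : ‖Q‖ ^ (N + 1) ≤ ‖Q‖ := pow_le_of_le_one (norm_nonneg _) hQ.le (by omega)
    linarith
  have h2 : 0 < 1 - ‖Q‖ := by linarith
  have h3 : ‖(-4 : ℂ)‖ = 4 := by norm_num
  have h4 : ‖(π : ℂ)‖ = π := by simp [Real.pi_pos.le]
  rw [h3, h4, div_mul_eq_mul_div]
  gcongr

lemma summable_even (f : ℤ → ℂ) (hf : ∀ m, f (-m) = f m)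
    (hs : Summable fun N : ℕ => f (-((N : ℤ) + 1))) : Summable f := by
  have h1 : Summable fun N : ℕ => f N := by
    rw [← summable_nat_add_iff 1]
    refine hs.congr fun N => ?_
    rw [hf]; push_cast; rfl
  exact Summable.of_nat_of_neg h1 (h1.congr fun N => (hf _).symm)

lemma summable_auxT (τ : ℂ) (hτ : 0 < τ.im) :
    Summable (auxT τ 2) ∧ Summable (auxT τ 4) ∧ Summable (auxT τ 6) ∧ Summable (auxT τ 8) := by
  have hv := fun N => auxT_vals τ hτ N _ rfl
  have s1 := summable_auxY τ hτ 1 (by norm_num)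
  have s2 := summable_auxY τ hτ 2 (by norm_num)
  have s3 := summable_auxY τ hτ 3 (by norm_num)
  have s4 := summable_auxY τ hτ 4 (by norm_num)
  simp only [pow_one] at s1
  refine ⟨summable_even _ (auxT_neg τ _ (by decide)) ?_,
    summable_even _ (auxT_neg τ _ (by decide)) ?_,
    summable_even _ (auxT_neg τ _ (by decide)) ?_,
    summable_even _ (auxT_neg τ _ (by decide)) ?_⟩
  · simp_rw [fun N => (hv N).1]
    exact s1.mul_left _
  · simp_rw [fun N => (hv N).2.1]
    exact (s2.sub (s1.mul_left _)).mul_left _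
  · simp_rw [fun N => (hv N).2.2.1]
    exact ((s3.sub (s2.mul_left _)).add (s1.mul_left _)).mul_left _
  · simp_rw [fun N => (hv N).2.2.2]
    exact (((s4.sub (s3.mul_left _)).add (s2.mul_left _)).sub (s1.mul_left _)).mul_left _

lemma auxT_zero (τ : ℂ) (k : ℕ) (hk : k ≠ 0) : auxT τ (2 * k) 0 = 1 / τ ^ (2 * k) *
    (2 * ((-1) ^ (k + 1) * (2 : ℂ) ^ (2 * k - 1) * (π : ℂ) ^ (2 * k) * bernoulli (2 * k) /
      (2 * k).factorial)) := by
  rw [← riemannZeta_two_mul_nat hk]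
  have := two_mul_riemannZeta_eq_tsum_int_inv_pow_of_even (k := 2 * k) (by omega) (by simp)
  push_cast at this
  rw [this, auxT, ← tsum_mul_left]
  refine tsum_congr fun n => ?_
  simp [mul_pow, mul_comm]

lemma bern_vals : bernoulli 4 = -1 / 30 ∧ bernoulli 6 = 1 / 42 ∧ bernoulli 8 = -1 / 30 := by
  have h5 : bernoulli' 5 = 0 := bernoulli'_eq_zero_of_odd (by decide) (by norm_num)
  have h7 : bernoulli' 7 = 0 := bernoulli'_eq_zero_of_odd (by decide) (by norm_num)
  have h6 : bernoulli' 6 = 1 / 42 := by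
    rw [bernoulli'_def]
    norm_num [Finset.sum_range_succ, h5, Nat.choose]
  have h8 : bernoulli' 8 = -1 / 30 := by
    rw [bernoulli'_def]
    norm_num [Finset.sum_range_succ, h5, h6, h7, Nat.choose]
  refine ⟨?_, ?_, ?_⟩ <;> rw [bernoulli_eq_bernoulli'_of_ne_one (by norm_num)]
  · exact bernoulli'_four
  · exact h6
  · exact h8

lemma auxT_main_neg (τ : ℂ) (hτ : 0 < τ.im) (N : ℕ) (m : ℤ) (hm : m = -((N : ℤ) + 1)) :
    auxT τ 2 m ^ 4 = auxT τ 8 m + 4 * (π : ℂ) ^ 2 / (3 * τ ^ 2) * auxT τ 6 m +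
      14 * (π : ℂ) ^ 4 / (15 * τ ^ 4) * auxT τ 4 m +
      16 * (π : ℂ) ^ 6 / (35 * τ ^ 6) * auxT τ 2 m := by
  have h0 : τ ≠ 0 := by rintro rfl; simp at hτ
  obtain ⟨h2, h4, h6, h8⟩ := auxT_vals τ hτ N _ rfl
  rw [hm, h2, h4, h6, h8]
  field_simp
  ring

lemma auxT_main (τ : ℂ) (hτ : 0 < τ.im) (m : ℤ) :
    auxT τ 2 m ^ 4 = auxT τ 8 m + 4 * (π : ℂ) ^ 2 / (3 * τ ^ 2) * auxT τ 6 m +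
      14 * (π : ℂ) ^ 4 / (15 * τ ^ 4) * auxT τ 4 m +
      16 * (π : ℂ) ^ 6 / (35 * τ ^ 6) * auxT τ 2 m -
      (if m = 0 then 86 * (π : ℂ) ^ 8 / (525 * τ ^ 8) else 0) := by
  have h0 : τ ≠ 0 := by rintro rfl; simp at hτ
  rcases lt_trichotomy m 0 with h | h | h
  · rw [if_neg h.ne, sub_zero]
    exact auxT_main_neg τ hτ (-m - 1).toNat m (by omega)
  · subst h
    obtain ⟨b4, b6, b8⟩ := bern_vals
    have h2 := auxT_zero τ 1 (by norm_num)
    have h4 := auxT_zero τ 2 (by norm_num)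
    have h6 := auxT_zero τ 3 (by norm_num)
    have h8 := auxT_zero τ 4 (by norm_num)
    norm_num [Nat.factorial, b4, b6, b8, bernoulli_two] at h2 h4 h6 h8
    rw [if_pos rfl, h2, h4, h6, h8]
    field_simp
    ring
  · rw [if_neg h.ne', sub_zero, ← auxT_neg τ 2 (by decide), ← auxT_neg τ 4 (by decide),
      ← auxT_neg τ 6 (by decide), ← auxT_neg τ 8 (by decide)]
    exact auxT_main_neg τ hτ (m - 1).toNat (-m) (by omega)

theorem tildeG_two_two_two_two (τ : ℂ) (hτ : 0 < τ.im) :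
    tildeG4 τ = G 8 τ + 4 * (π : ℂ) ^ 2 / (3 * τ ^ 2) * G 6 τ +
      14 * (π : ℂ) ^ 4 / (15 * τ ^ 4) * G 4 τ +
      16 * (π : ℂ) ^ 6 / (35 * τ ^ 6) * G 2 τ - 86 * (π : ℂ) ^ 8 / (525 * τ ^ 8) := by
  obtain ⟨s2, s4, s6, s8⟩ := summable_auxT τ hτ
  rw [tildeG4_eq, G_eq 8 (by norm_num), G_eq 6 (by norm_num), G_eq 4 (by norm_num),
    G_eq 2 (by norm_num)]
  have hd := hasSum_ite_eq (0 : ℤ) (86 * (π : ℂ) ^ 8 / (525 * τ ^ 8))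
  have := ((((s8.hasSum.add (s6.hasSum.mul_left (4 * (π : ℂ) ^ 2 / (3 * τ ^ 2)))).add
    (s4.hasSum.mul_left (14 * (π : ℂ) ^ 4 / (15 * τ ^ 4)))).add
    (s2.hasSum.mul_left (16 * (π : ℂ) ^ 6 / (35 * τ ^ 6)))).sub hd).tsum_eq
  rw [← this]
  exact tsum_congr fun m => auxT_main τ hτ m
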